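/- The distributed language VC-CYCLE-DIM, consisting of all configurations (G,k) in which every node's input is the same nonnegative integer k and there exists a set X ⊆ V(G) with |X| ≥ k such that for every subset S ⊆ X there is a cycle of G containing every vertex of S and no vertex of X∖S (i.e., the cycle-VC-dimension of G is at least k), is in Λ_3. -/

import Mathlib

/-!
Distributed decision in the LOCAL model: configurations, local algorithms,
the local hierarchy Σ_k / Π_k / Λ_k and co-Λ_k.
-/

/-- A configuration: a finite connected simple graph on `Fin n` (with `n ≥ 1`)
together with an input bit string at each node. -/
structure Config where
  n : ℕ
  npos : 0 < n
  G : SimpleGraph (Fin n)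
  conn : G.Connected
  x : Fin n → List Bool

/-- The ball of radius `t` around `v`: all nodes at distance at most `t`. -/
def ball (C : Config) (v : Fin C.n) (t : ℕ) : Set (Fin C.n) :=
  {u | C.G.dist v u ≤ t}

lemma self_mem_ball (C : Config) (v : Fin C.n) (t : ℕ) : v ∈ ball C v t := by
  simp [ball, SimpleGraph.dist_self]

/-- A `t`-round local algorithm: at each node it outputs a bit, computed from the whole
configuration, identity assignment and labellings, subject to locality: the output at `v`
only depends on the ball of radius `t` around `v` together with the inputs, identities and
labellings on it (isomorphic labelled balls give equal outputs). -/
structure LocalAlg where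
  t : ℕ
  run : (C : Config) → (Fin C.n → ℕ) → (ℕ → Fin C.n → List Bool) → Fin C.n → Bool
  isLocal : ∀ (C C' : Config) (ident : Fin C.n → ℕ) (ident' : Fin C'.n → ℕ)
      (ℓ : ℕ → Fin C.n → List Bool) (ℓ' : ℕ → Fin C'.n → List Bool)
      (v : Fin C.n) (v' : Fin C'.n)
      (φ : (C.G.induce (ball C v t)) ≃g (C'.G.induce (ball C' v' t))),
      ((φ ⟨v, self_mem_ball C v t⟩).val = v') →
      (∀ u : ball C v t, C'.x (φ u).val = C.x u.val) →
      (∀ u : ball C v t, ident' (φ u).val = ident u.val) →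
      (∀ (i : ℕ) (u : ball C v t), ℓ' i (φ u).val = ℓ i u.val) →
      run C ident ℓ v = run C' ident' ℓ' v'

/-- A labelling of size `c · log₂ n`. -/
def goodLabel (c : ℕ) (C : Config) (ℓ : Fin C.n → List Bool) : Prop :=
  ∀ v, (ℓ v).length ≤ c * Nat.log 2 C.n

/-- Alternating quantification over `j` further labellings (stored at indices `i, i+1, …`),
starting with an existential quantifier when the `Bool` argument is `true` and with a
universal quantifier when it is `false`; `P` is the final predicate. -/
def altQ (c : ℕ) (C : Config) (P : (ℕ → Fin C.n → List Bool) → Prop) :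
    ℕ → ℕ → Bool → (ℕ → Fin C.n → List Bool) → Prop
  | 0, _, _, ℓs => P ℓs
  | j + 1, i, true, ℓs =>
      ∃ ℓ, goodLabel c C ℓ ∧ altQ c C P j (i + 1) false (Function.update ℓs i ℓ)
  | j + 1, i, false, ℓs =>
      ∀ ℓ, goodLabel c C ℓ → altQ c C P j (i + 1) true (Function.update ℓs i ℓ)

/-- Global acceptance: every node outputs 1. -/
def accepts (A : LocalAlg) (C : Config) (ident : Fin C.n → ℕ)
    (ℓs : ℕ → Fin C.n → List Bool) : Prop :=
  ∀ v, A.run C ident ℓs v = true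

/-- The empty collection of labellings. -/
def noLabels (C : Config) : ℕ → Fin C.n → List Bool := fun _ _ => []

/-- Inputs are bounded by `α · log₂ n` bits. -/
def BoundedInput (α : ℕ) (C : Config) : Prop :=
  ∀ v, (C.x v).length ≤ α * Nat.log 2 C.n

/-- An identity assignment: injective, with values in `{1, …, n^β}`. -/
def IsIdAssignment (β : ℕ) (C : Config) (ident : Fin C.n → ℕ) : Prop :=
  Function.Injective ident ∧ ∀ v, 1 ≤ ident v ∧ ident v ≤ C.n ^ β

/-- The class `Σ_k` (with input-size constant `α` and identity-space constant `β`):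
`(G,x) ∈ L ⟺ ∃ℓ₁ ∀ℓ₂ … Q ℓ_k`, `A` accepts, for every identity assignment. -/
def SigmaC (α β k : ℕ) (L : Set Config) : Prop :=
  ∃ (A : LocalAlg) (c : ℕ), ∀ C : Config, BoundedInput α C →
    ∀ ident : Fin C.n → ℕ, IsIdAssignment β C ident →
      (C ∈ L ↔ altQ c C (accepts A C ident) k 0 true (noLabels C))

/-- The class `Π_k`: as `Σ_k` but the alternation starts with a universal quantifier. -/
def PiC (α β k : ℕ) (L : Set Config) : Prop :=
  ∃ (A : LocalAlg) (c : ℕ), ∀ C : Config, BoundedInput α C →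
    ∀ ident : Fin C.n → ℕ, IsIdAssignment β C ident →
      (C ∈ L ↔ altQ c C (accepts A C ident) k 0 false (noLabels C))

/-- `Λ_k := Σ_k` for odd `k`, `Λ_k := Π_k` for even `k` (so `Λ_0 = LD`). -/
def LambdaC (α β k : ℕ) (L : Set Config) : Prop :=
  if k % 2 = 1 then SigmaC α β k L else PiC α β k L

/-- `co-Λ_k`: the complement (within the set of all configurations) is in `Λ_k`. -/
def coLambdaC (α β k : ℕ) (L : Set Config) : Prop :=
  LambdaC α β k ({C : Config | BoundedInput α C} \ L)

/-- Input-preserving isomorphism of configurations. -/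
def ConfigIso (C C' : Config) : Prop :=
  ∃ φ : C.G ≃g C'.G, ∀ v, C'.x (φ v) = C.x v

/-- A distributed language: a set of configurations (with bounded inputs)
closed under input-preserving isomorphism. -/
def IsDistLang (α : ℕ) (L : Set Config) : Prop :=
  (∀ C ∈ L, BoundedInput α C) ∧ ∀ C C', ConfigIso C C' → (C ∈ L ↔ C' ∈ L)

/-- The leading quantifier of `Λ_k`: existential iff `k` is odd. -/
def startEx (k : ℕ) : Bool := decide (k % 2 = 1)

/-- `VC-CYCLE-DIM`: every node's input is (the binary representation of) the same `k ≥ 0`,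
and there is a set `X` of at least `k` vertices such that for every `S ⊆ X` some cycle of
`G` contains every vertex of `S` and no vertex of `X \ S`. -/
def VCCycleLang : Set Config :=
  {C | ∃ k : ℕ, (∀ v, C.x v = Nat.bits k) ∧
    ∃ X : Finset (Fin C.n), k ≤ X.card ∧
      ∀ S ⊆ X, ∃ (v : Fin C.n) (c : C.G.Walk v v), c.IsCycle ∧
        (∀ u ∈ S, u ∈ c.support) ∧ (∀ u ∈ X, u ∉ S → u ∉ c.support)}

/-! ### Binary encodings of tuples -/

theorem bits_injective : Function.Injective Nat.bits := by
  intro a b h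
  refine Nat.eq_of_testBit_eq fun i => ?_
  rw [Nat.testBit_eq_inth, Nat.testBit_eq_inth, h]

/-- The number written in binary by a bit string. -/
noncomputable def decodeNat (l : List Bool) : ℕ := Function.invFun Nat.bits l

@[simp] theorem decodeNat_bits (m : ℕ) : decodeNat (Nat.bits m) = m :=
  Function.leftInverse_invFun bits_injective m

theorem length_bits_le {m e : ℕ} (h : m < 2 ^ e) : (Nat.bits m).length ≤ e := by
  rw [Nat.size_eq_bits_len]
  exact Nat.size_le.2 h

theorem lt_two_pow_length_bits (m : ℕ) : m < 2 ^ (Nat.bits m).length := by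
  rw [Nat.size_eq_bits_len]
  exact Nat.size_le.1 le_rfl

theorem pair_lt_two_pow {a b e : ℕ} (ha : a < 2 ^ e) (hb : b < 2 ^ e) :
    Nat.pair a b < 2 ^ (2 * e) := by
  calc Nat.pair a b < (max a b + 1) ^ 2 := Nat.pair_lt_max_add_one_sq a b
    _ ≤ (2 ^ e) ^ 2 := Nat.pow_le_pow_left (by omega) 2
    _ = 2 ^ (2 * e) := by rw [← pow_mul, mul_comm]

theorem lt_two_pow_mono {a e f : ℕ} (ha : a < 2 ^ e) (h : e ≤ f) : a < 2 ^ f :=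
  ha.trans_le (Nat.pow_le_pow_right two_pos h)

theorem pow_lt_two_pow_log {n β : ℕ} (hn : 2 ≤ n) (hβ : 1 ≤ β) :
    n ^ β < 2 ^ (2 * β * Nat.log 2 n) := by
  have hlog : 1 ≤ Nat.log 2 n := Nat.log_pos one_lt_two hn
  calc n ^ β < (2 ^ (Nat.log 2 n + 1)) ^ β :=
        Nat.pow_lt_pow_left (Nat.lt_pow_succ_log_self one_lt_two n) (by omega)
    _ = 2 ^ ((Nat.log 2 n + 1) * β) := by rw [← pow_mul]
    _ ≤ 2 ^ (2 * β * Nat.log 2 n) := Nat.pow_le_pow_right two_pos (by nlinarith)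

/-! ### One-round algorithms -/

/-- What a node knows about itself. -/
structure NodeView where
  input : List Bool
  ident : ℕ
  label : ℕ → List Bool

/-- The view of the node `v`. -/
def nodeView (C : Config) (ident : Fin C.n → ℕ) (ℓ : ℕ → Fin C.n → List Bool)
    (v : Fin C.n) : NodeView :=
  ⟨C.x v, ident v, fun i => ℓ i v⟩

theorem neighborViews_subset {C C' : Config} {ident : Fin C.n → ℕ} {ident' : Fin C'.n → ℕ}
    {ℓ : ℕ → Fin C.n → List Bool} {ℓ' : ℕ → Fin C'.n → List Bool} {v : Fin C.n} {v' : Fin C'.n}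
    (φ : (C.G.induce (ball C v 1)) ≃g (C'.G.induce (ball C' v' 1)))
    (hv : (φ ⟨v, self_mem_ball C v 1⟩).val = v')
    (hview : ∀ u : ball C v 1, nodeView C' ident' ℓ' (φ u).val = nodeView C ident ℓ u.val) :
    nodeView C ident ℓ '' C.G.neighborSet v ⊆
      nodeView C' ident' ℓ' '' C'.G.neighborSet v' := by
  rintro _ ⟨u, hu, rfl⟩
  have hu' : C.G.Adj v u := hu
  have hball : u ∈ ball C v 1 := (SimpleGraph.dist_eq_one_iff_adj.2 hu').le
  refine ⟨(φ ⟨u, hball⟩).val, ?_, hview _⟩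
  have hadj : (C.G.induce (ball C v 1)).Adj ⟨v, self_mem_ball C v 1⟩ ⟨u, hball⟩ := hu'
  have hadj' : C'.G.Adj (φ ⟨v, self_mem_ball C v 1⟩).val (φ ⟨u, hball⟩).val :=
    φ.map_rel_iff.2 hadj
  rwa [hv] at hadj'

open Classical in
/-- The one-round algorithm in which a node evaluates a predicate of its own view and of the set
of the views of its neighbours. -/
noncomputable def oneRoundAlg (P : NodeView → Set NodeView → Prop) : LocalAlg where
  t := 1
  run C ident ℓ v :=
    decide (P (nodeView C ident ℓ v) (nodeView C ident ℓ '' C.G.neighborSet v))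
  isLocal := by
    intro C C' ident ident' ℓ ℓ' v v' φ hv hx hid hℓ
    have hview : ∀ u : ball C v 1,
        nodeView C' ident' ℓ' (φ u).val = nodeView C ident ℓ u.val := by
      intro u
      simp only [nodeView, hx u, hid u, hℓ _ u]
    have hself : nodeView C' ident' ℓ' v' = nodeView C ident ℓ v := by
      rw [← hv]
      exact hview _
    have hsymm : (φ.symm ⟨v', self_mem_ball C' v' 1⟩).val = v := by
      have : (⟨v', self_mem_ball C' v' 1⟩ : ball C' v' 1) = φ ⟨v, self_mem_ball C v 1⟩ :=
        Subtype.ext hv.symm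
      rw [this, φ.symm_apply_apply]
    have hnbr : nodeView C ident ℓ '' C.G.neighborSet v =
        nodeView C' ident' ℓ' '' C'.G.neighborSet v' := by
      refine (neighborViews_subset φ hv hview).antisymm
        (neighborViews_subset φ.symm hsymm fun u => ?_)
      rw [← hview, φ.apply_symm_apply]
    simp only [hself, hnbr]

theorem accepts_oneRoundAlg {P : NodeView → Set NodeView → Prop} {C : Config}
    {ident : Fin C.n → ℕ} {ℓ : ℕ → Fin C.n → List Bool} :
    accepts (oneRoundAlg P) C ident ℓ ↔
      ∀ v, P (nodeView C ident ℓ v) (nodeView C ident ℓ '' C.G.neighborSet v) := by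
  simp [accepts, oneRoundAlg]

/-! ### Decreasing potentials -/

theorem exists_of_potential {V : Type*} [Nonempty V] {G : SimpleGraph V} {P : V → Prop}
    {d : V → ℕ} (h : ∀ v, P v ∨ ∃ u, G.Adj v u ∧ d u < d v) : ∃ v, P v := by
  by_contra! hP
  have key : ∀ m v, d v ≠ m := by
    intro m
    induction m using Nat.strong_induction_on with
    | _ m ih =>
      rintro v rfl
      obtain ⟨u, -, hu⟩ := (h v).resolve_left (hP v)
      exact ih _ hu u rfl
  exact key _ (Classical.arbitrary V) rfl

theorem SimpleGraph.Connected.exists_potential {V : Type*} [Fintype V] {G : SimpleGraph V}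
    (hG : G.Connected) (r : V) :
    ∃ d : V → ℕ, (∀ v, d v < Fintype.card V) ∧ ∀ v, v = r ∨ ∃ u, G.Adj v u ∧ d u < d v := by
  refine ⟨fun v => G.dist v r, fun v => ?_, fun v => ?_⟩
  · obtain ⟨p, hp, hlen⟩ := hG.exists_path_of_dist v r
    exact hlen.symm.trans_lt hp.length_lt
  · obtain ⟨p, hlen⟩ := hG.exists_walk_length_eq_dist v r
    cases p with
    | nil => exact Or.inl rfl
    | cons h p =>
      refine Or.inr ⟨_, h, ?_⟩
      have := SimpleGraph.dist_le p
      rw [SimpleGraph.Walk.length_cons] at hlen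
      dsimp only
      omega

theorem SimpleGraph.Connected.eq_of_forall_adj {V α : Type*} {G : SimpleGraph V}
    (hG : G.Connected) {f : V → α} (h : ∀ u v, G.Adj u v → f v = f u) (u v : V) : f u = f v := by
  obtain ⟨p⟩ := hG.preconnected u v
  induction p with
  | nil => rfl
  | cons hadj _ ih => rw [← ih, h _ _ hadj]

/-! ### Locally checkable cycles -/

/-- The vertices `u` with `q u ≠ 0` form a cycle: they are numbered `1, …, M + 1` by `q`, starting
from `r`, along the cycle. -/
structure CycleNumbering {V : Type*} (G : SimpleGraph V) (r : V) (M : ℕ) (q : V → ℕ) : Prop where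
  two_le : 2 ≤ M
  le : ∀ u, q u ≤ M + 1
  root : ∀ u, q u = 1 → u = r
  close : ∀ u, q u = 1 → ∃ w, G.Adj u w ∧ q w = M + 1
  pred : ∀ u p, q u = p + 2 → ∃ w, G.Adj u w ∧ q w = p + 1
  succ : ∀ u, q u ≠ 0 → ∀ w w', G.Adj u w → G.Adj u w' → q w = q u + 1 → q w' = q u + 1 → w = w'

namespace CycleNumbering

variable {V : Type*} {G : SimpleGraph V} {r : V} {M : ℕ} {q : V → ℕ}

theorem injOn (h : CycleNumbering G r M q) (p : ℕ) :
    ∀ u v, q u = p + 1 → q v = p + 1 → u = v := by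
  induction p with
  | zero => exact fun u v hu hv => (h.root u hu).trans (h.root v hv).symm
  | succ p ih =>
    intro u v hu hv
    obtain ⟨a, ha, hqa⟩ := h.pred u p hu
    obtain ⟨b, hb, hqb⟩ := h.pred v p hv
    obtain rfl := ih a b hqa hqb
    exact h.succ a (by omega) u v ha.symm hb.symm (by omega) (by omega)

theorem exists_path (h : CycleNumbering G r M q) (p : ℕ) :
    ∀ u, q u = p + 1 → ∃ w : G.Walk r u, w.IsPath ∧
      (∀ x, x ∈ w.support ↔ q x ≠ 0 ∧ q x ≤ p + 1) ∧
      ∀ a b, s(a, b) ∈ w.edges → q a = q b + 1 ∨ q b = q a + 1 := by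
  induction p with
  | zero =>
    intro u hu
    obtain rfl := h.root u hu
    refine ⟨.nil, .nil, fun x => ?_, by simp⟩
    rw [SimpleGraph.Walk.support_nil, List.mem_singleton]
    refine ⟨?_, fun hx => h.root x (by omega)⟩
    rintro rfl
    omega
  | succ p ih =>
    intro u hu
    obtain ⟨a, ha, hqa⟩ := h.pred u p hu
    obtain ⟨w, hw, hsupp, hedge⟩ := ih a hqa
    refine ⟨w.concat ha.symm, hw.concat (fun hmem => ?_) _, fun x => ?_, fun b c hbc => ?_⟩
    · have := (hsupp u).1 hmem
      omega
    · rw [SimpleGraph.Walk.support_concat, List.mem_append,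
        List.mem_singleton, hsupp]
      constructor
      · rintro (hx | rfl) <;> omega
      · intro hx
        rcases eq_or_ne (q x) (p + 1 + 1) with hx' | hx'
        · exact Or.inr (h.injOn (p + 1) x u hx' hu)
        · exact Or.inl ⟨hx.1, by omega⟩
    · rw [SimpleGraph.Walk.edges_concat, List.concat_eq_append, List.mem_append,
        List.mem_singleton] at hbc
      rcases hbc with hbc | hbc
      · exact hedge b c hbc
      · rcases Sym2.eq_iff.1 hbc with ⟨rfl, rfl⟩ | ⟨rfl, rfl⟩ <;> omega

theorem exists_one (h : CycleNumbering G r M q) (p : ℕ) : ∀ u, q u = p + 1 → ∃ v, q v = 1 := by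
  induction p with
  | zero => exact fun u hu => ⟨u, hu⟩
  | succ p ih =>
    intro u hu
    obtain ⟨a, -, hqa⟩ := h.pred u p hu
    exact ih a hqa

/-- The numbered vertices are the vertices of a cycle. -/
theorem exists_isCycle (h : CycleNumbering G r M q) (hne : ∃ u, q u ≠ 0) :
    ∃ (v : V) (c : G.Walk v v), c.IsCycle ∧ ∀ u, u ∈ c.support ↔ q u ≠ 0 := by
  obtain ⟨u, hu⟩ := hne
  obtain ⟨a, ha⟩ := h.exists_one (q u - 1) u (by omega)
  obtain ⟨w, haw, hw⟩ := h.close a ha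
  obtain rfl := h.root a ha
  obtain ⟨p, hp, hsupp, hedge⟩ := h.exists_path M w hw
  refine ⟨w, .cons haw.symm p, (SimpleGraph.Walk.cons_isCycle_iff _ _).2 ⟨hp, fun he => ?_⟩,
    fun x => ?_⟩
  · have := hedge _ _ he
    have := h.two_le
    omega
  · rw [SimpleGraph.Walk.support_cons, List.mem_cons, hsupp]
    have := h.le x
    constructor
    · rintro (rfl | hx) <;> omega
    · exact fun hx => Or.inr ⟨hx, this⟩

/-- The vertices of a cycle can be numbered along it. -/
theorem of_isCycle [Fintype V] {v : V} {c : G.Walk v v} (hc : c.IsCycle) :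
    ∃ (M : ℕ) (q : V → ℕ), CycleNumbering G v M q ∧ M < Fintype.card V ∧
      ∀ u, u ∈ c.support ↔ q u ≠ 0 := by
  classical
  have h3 := hc.three_le_length
  have hcard : c.length ≤ Fintype.card V := by
    have := hc.support_nodup.length_le_card
    simpa using this
  have hex : ∀ u ∈ c.support, ∃ i < c.length, c.getVert i = u := by
    intro u hu
    obtain ⟨i, rfl, hi⟩ := SimpleGraph.Walk.mem_support_iff_exists_getVert.1 hu
    rcases hi.lt_or_eq with hi | rfl
    · exact ⟨i, hi, rfl⟩
    · exact ⟨0, by omega, by simp⟩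
  choose! f hf hfu using hex
  let q : V → ℕ := fun u => if u ∈ c.support then f u + 1 else 0
  have hinj : ∀ i j, i < c.length → j < c.length → c.getVert i = c.getVert j → i = j :=
    fun i j hi hj hij => hc.getVert_injOn' (by simp only [Set.mem_ofPred_eq]; omega)
      (by simp only [Set.mem_ofPred_eq]; omega) hij
  have hq : ∀ u p, q u = p + 1 ↔ p < c.length ∧ c.getVert p = u := by
    intro u p
    by_cases hu : u ∈ c.support
    · simp only [q, if_pos hu, Nat.add_right_cancel_iff]
      refine ⟨?_, fun ⟨hp, hpu⟩ => hinj _ _ (hf u hu) hp ((hfu u hu).trans hpu.symm)⟩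
      rintro rfl
      exact ⟨hf u hu, hfu u hu⟩
    · simp only [q, if_neg hu]
      refine ⟨fun h => by omega, ?_⟩
      rintro ⟨-, rfl⟩
      exact absurd (c.getVert_mem_support p) hu
  have hlast : c.length - 1 + 1 = c.length := by omega
  refine ⟨c.length - 1, q, ⟨by omega, fun u => ?_, fun u hu => ?_, fun u hu => ?_,
    fun u p hu => ?_, fun u hu w w' _ _ hw hw' => ?_⟩, by omega, fun u => ?_⟩
  · by_contra! hu
    have := ((hq u (q u - 1)).1 (by omega)).1
    omega
  · simpa using ((hq u 0).1 hu).2.symm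
  · have hu' : v = u := by simpa using ((hq u 0).1 hu).2
    subst hu'
    refine ⟨c.getVert (c.length - 1), ?_, (hq _ _).2 ⟨by omega, rfl⟩⟩
    have hadj := c.adj_getVert_succ (i := c.length - 1) (by omega)
    rw [hlast, c.getVert_length] at hadj
    exact hadj.symm
  · obtain ⟨hp, rfl⟩ := (hq u (p + 1)).1 hu
    exact ⟨c.getVert p, (c.adj_getVert_succ (by omega)).symm, (hq _ _).2 ⟨by omega, rfl⟩⟩
  · rw [← ((hq w (q u)).1 hw).2, ← ((hq w' (q u)).1 hw').2]
  · by_cases hu : u ∈ c.support <;> simp [q, hu]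

end CycleNumbering

/-! ### The verifier -/

namespace NodeView

/-- The dimension claimed by the input. -/
noncomputable def dim (a : NodeView) : ℕ := decodeNat a.input

/-- `j + 1` for the `j`-th element of the set claimed to be shattered, and `0` outside. -/
noncomputable def index (a : NodeView) : ℕ := decodeNat (a.label 0)

/-- The challenged position in the enumeration of the shattered set. -/
noncomputable def target (a : NodeView) : ℕ := decodeNat (a.label 1) / 2

/-- Whether the node is in the challenged trace. -/
def InTrace (a : NodeView) : Prop := decodeNat (a.label 1) % 2 = 1

/-- The potential leading to a node that answers the challenged position. -/
noncomputable def targetPot (a : NodeView) : ℕ := (decodeNat (a.label 2)).unpair.1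

/-- The potential leading to the cycle. -/
noncomputable def cyclePot (a : NodeView) : ℕ := (decodeNat (a.label 2)).unpair.2.unpair.1

/-- The identity of the first vertex of the cycle. -/
noncomputable def root (a : NodeView) : ℕ := (decodeNat (a.label 2)).unpair.2.unpair.2.unpair.1

/-- The length of the cycle, minus one. -/
noncomputable def last (a : NodeView) : ℕ :=
  (decodeNat (a.label 2)).unpair.2.unpair.2.unpair.2.unpair.1

/-- The number of the node along the cycle, and `0` outside. -/
noncomputable def pos (a : NodeView) : ℕ :=
  (decodeNat (a.label 2)).unpair.2.unpair.2.unpair.2.unpair.2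

end NodeView

/-- The checks made by a node with view `a`, when `N` is the set of the views of its
neighbours. -/
structure CycleDimCheck (a : NodeView) (N : Set NodeView) : Prop where
  input : ∃ k, a.input = Nat.bits k
  nonempty : N.Nonempty
  input_eq : ∀ b ∈ N, b.input = a.input
  target : ((∃ b ∈ N, b.target ≠ a.target) ∨ a.dim ≤ a.target ∨ a.index = a.target + 1) ∨
    ∃ b ∈ N, b.targetPot < a.targetPot
  cycle : a.pos ≠ 0 ∨ ∃ b ∈ N, b.cyclePot < a.cyclePot
  root_eq : ∀ b ∈ N, b.root = a.root
  last_eq : ∀ b ∈ N, b.last = a.last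
  two_le : 2 ≤ a.last
  pos_le : a.pos ≤ a.last + 1
  root : a.pos = 1 → a.ident = a.root
  close : a.pos = 1 → ∃ b ∈ N, b.pos = a.last + 1
  pred : ∀ p, a.pos = p + 2 → ∃ b ∈ N, b.pos = p + 1
  succ : a.pos ≠ 0 → ∀ b ∈ N, ∀ b' ∈ N, b.pos = a.pos + 1 → b'.pos = a.pos + 1 →
    b.ident = b'.ident
  trace : a.index ≠ 0 → (a.pos ≠ 0 ↔ a.InTrace)

/-- The three labellings, as one family. -/
def threeLabels (C : Config) (ℓ₁ ℓ₂ ℓ₃ : Fin C.n → List Bool) : ℕ → Fin C.n → List Bool :=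
  Function.update (Function.update (Function.update (noLabels C) 0 ℓ₁) 1 ℓ₂) 2 ℓ₃

section threeLabels

variable (C : Config) (ℓ₁ ℓ₂ ℓ₃ : Fin C.n → List Bool)

@[simp] theorem threeLabels_zero : threeLabels C ℓ₁ ℓ₂ ℓ₃ 0 = ℓ₁ := by simp [threeLabels]

@[simp] theorem threeLabels_one : threeLabels C ℓ₁ ℓ₂ ℓ₃ 1 = ℓ₂ := by simp [threeLabels]

@[simp] theorem threeLabels_two : threeLabels C ℓ₁ ℓ₂ ℓ₃ 2 = ℓ₃ := by simp [threeLabels]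

end threeLabels

theorem altQ_three_iff {c : ℕ} {C : Config} {P : (ℕ → Fin C.n → List Bool) → Prop} :
    altQ c C P 3 0 true (noLabels C) ↔
      ∃ ℓ₁, goodLabel c C ℓ₁ ∧ ∀ ℓ₂, goodLabel c C ℓ₂ → ∃ ℓ₃, goodLabel c C ℓ₃ ∧
        P (threeLabels C ℓ₁ ℓ₂ ℓ₃) := Iff.rfl

/-- The cycle encoded by accepted labels. -/
theorem exists_isCycle_of_check {C : Config} {ident : Fin C.n → ℕ}
    (hid : Function.Injective ident) {ℓ : ℕ → Fin C.n → List Bool}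
    (h : ∀ v, CycleDimCheck (nodeView C ident ℓ v) (nodeView C ident ℓ '' C.G.neighborSet v)) :
    ∃ (v : Fin C.n) (c : C.G.Walk v v), c.IsCycle ∧
      ∀ u, u ∈ c.support ↔ (nodeView C ident ℓ u).pos ≠ 0 := by
  set a := nodeView C ident ℓ
  have : Nonempty (Fin C.n) := C.conn.nonempty
  have hmem : ∀ {u v}, C.G.Adj u v → a v ∈ a '' C.G.neighborSet u := fun huv => ⟨_, huv, rfl⟩
  have hroot := C.conn.eq_of_forall_adj (f := fun v => (a v).root)
    fun u v huv => (h u).root_eq _ (hmem huv)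
  have hlast := C.conn.eq_of_forall_adj (f := fun v => (a v).last)
    fun u v huv => (h u).last_eq _ (hmem huv)
  have hne : ∃ u, (a u).pos ≠ 0 := by
    refine exists_of_potential (G := C.G) (d := fun v => (a v).cyclePot) fun v => ?_
    rcases (h v).cycle with hv | ⟨_, ⟨u, hu, rfl⟩, hlt⟩
    · exact Or.inl hv
    · exact Or.inr ⟨u, hu, hlt⟩
  by_cases hr : ∃ r, (a r).pos = 1
  · obtain ⟨r, hr⟩ := hr
    have hnum : CycleNumbering C.G r (a r).last (fun v => (a v).pos) := by
      refine ⟨(h r).two_le, fun u => ?_, fun u hu => ?_, fun u hu => ?_, fun u p hu => ?_,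
        fun u hu w w' hw hw' hqw hqw' => ?_⟩
      · rw [hlast r u]
        exact (h u).pos_le
      · exact hid (((h u).root hu).trans ((hroot u r).trans ((h r).root hr).symm))
      · obtain ⟨_, ⟨w, hw, rfl⟩, hq⟩ := (h u).close hu
        exact ⟨w, hw, hq.trans (by rw [hlast u r])⟩
      · obtain ⟨_, ⟨w, hw, rfl⟩, hq⟩ := (h u).pred p hu
        exact ⟨w, hw, hq⟩
      · exact hid ((h u).succ hu _ (hmem hw) _ (hmem hw') hqw hqw')
    exact hnum.exists_isCycle hne
  · exfalso
    have key : ∀ p u, (a u).pos ≠ p + 1 := by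
      intro p
      induction p with
      | zero => exact fun u hu => hr ⟨u, hu⟩
      | succ p ih =>
        intro u hu
        obtain ⟨_, ⟨w, -, rfl⟩, hq⟩ := (h u).pred p hu
        exact ih w hq
    obtain ⟨u, hu⟩ := hne
    exact key ((a u).pos - 1) u (by omega)

/-- Labels that can be certified against every challenge come from a shattered set. -/
theorem mem_VCCycleLang_of_check {α c : ℕ} {C : Config} (hx : BoundedInput α C)
    (hc : α + 1 ≤ c) {ident : Fin C.n → ℕ} (hid : Function.Injective ident)
    {ℓ₁ : Fin C.n → List Bool}
    (h : ∀ ℓ₂, goodLabel c C ℓ₂ → ∃ ℓ₃, ∀ v,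
      CycleDimCheck (nodeView C ident (threeLabels C ℓ₁ ℓ₂ ℓ₃) v)
        (nodeView C ident (threeLabels C ℓ₁ ℓ₂ ℓ₃) '' C.G.neighborSet v)) :
    C ∈ VCCycleLang := by
  classical
  have : Nonempty (Fin C.n) := C.conn.nonempty
  let v₀ : Fin C.n := Classical.arbitrary _
  obtain ⟨ℓ, hℓ⟩ := h (fun _ => []) (fun _ => Nat.zero_le _)
  obtain ⟨k, hk : C.x v₀ = Nat.bits k⟩ := (hℓ v₀).input
  have hinput : ∀ v, C.x v = Nat.bits k := fun v =>
    (C.conn.eq_of_forall_adj (f := C.x)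
      (fun u w huw => (hℓ u).input_eq _ ⟨w, huw, rfl⟩) v v₀).trans hk
  have hlog : 1 ≤ Nat.log 2 C.n := by
    obtain ⟨_, u, hu, -⟩ := (hℓ v₀).nonempty
    have hne : v₀ ≠ u := SimpleGraph.Adj.ne hu
    refine Nat.log_pos one_lt_two ?_
    by_contra! hn
    exact hne (Fin.ext (by omega))
  refine ⟨k, hinput, Finset.univ.filter fun v => decodeNat (ℓ₁ v) ≠ 0, ?_, fun S hS => ?_⟩
  · have hsurj : ∀ i < k, ∃ v, decodeNat (ℓ₁ v) = i + 1 := by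
      intro i hi
      have hsize : 2 * i < 2 ^ (c * Nat.log 2 C.n) := by
        have hkx : k < 2 ^ (α * Nat.log 2 C.n) :=
          lt_two_pow_mono (lt_two_pow_length_bits k) (hk ▸ hx v₀)
        have hpow : 2 ^ (α * Nat.log 2 C.n + 1) ≤ 2 ^ (c * Nat.log 2 C.n) :=
          Nat.pow_le_pow_right two_pos (by nlinarith)
        rw [pow_succ] at hpow
        omega
      obtain ⟨ℓ', hℓ'⟩ := h (fun _ => Nat.bits (2 * i)) fun _ => length_bits_le hsize
      refine exists_of_potential (G := C.G) (d := fun v =>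
        (nodeView C ident (threeLabels C ℓ₁ (fun _ => Nat.bits (2 * i)) ℓ') v).targetPot)
        fun v => ?_
      rcases (hℓ' v).target with (⟨_, ⟨u, -, rfl⟩, hne⟩ | hle | heq) | ⟨_, ⟨u, hu, rfl⟩, hlt⟩
      · exact absurd rfl hne
      · simp only [NodeView.dim, NodeView.target, nodeView, threeLabels_one, hinput,
          decodeNat_bits] at hle
        omega
      · left
        simp only [NodeView.index, NodeView.target, nodeView, threeLabels_one, threeLabels_zero,
          decodeNat_bits] at heq
        omega
      · exact Or.inr ⟨u, hu, hlt⟩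
    choose! g hg using hsurj
    have := Finset.card_le_card_of_injOn (s := Finset.range k)
      (t := Finset.univ.filter fun v => decodeNat (ℓ₁ v) ≠ 0) g
      (fun i hi => by
        have := hg i (by simpa using hi)
        simp [this])
      (fun i hi j hj hij => by
        have h1 := hg i (by simpa using hi)
        have h2 := hg j (by simpa using hj)
        rw [hij] at h1
        omega)
    simpa using this
  · have hgood : goodLabel c C fun v => Nat.bits (if v ∈ S then 1 else 0) := by
      intro v
      have : 1 ≤ c * Nat.log 2 C.n := Nat.mul_pos (by omega) hlog
      refine (length_bits_le (e := 1) ?_).trans this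
      split <;> norm_num
    obtain ⟨ℓ', hℓ'⟩ := h _ hgood
    obtain ⟨v, p, hp, hsupp⟩ := exists_isCycle_of_check hid hℓ'
    have htrace : ∀ u, decodeNat (ℓ₁ u) ≠ 0 → (u ∈ p.support ↔ u ∈ S) := by
      intro u hu
      rw [hsupp, (hℓ' u).trace (by simpa [NodeView.index, nodeView] using hu)]
      simp only [NodeView.InTrace, nodeView, threeLabels_one, decodeNat_bits]
      by_cases huS : u ∈ S <;> simp [huS]
    have hX : ∀ u ∈ Finset.univ.filter (fun v => decodeNat (ℓ₁ v) ≠ 0),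
        decodeNat (ℓ₁ u) ≠ 0 := fun u hu => (Finset.mem_filter.1 hu).2
    exact ⟨v, p, hp, fun u hu => (htrace u (hX u (hS hu))).2 hu,
      fun u hu huS hmem => huS ((htrace u (hX u hu)).1 hmem)⟩

/-- Every challenge to an enumerated shattered set can be answered. -/
theorem exists_check_of_shattered {β c : ℕ} (hβ : 1 ≤ β) {C : Config} (hc : 32 * β ≤ c)
    {ident : Fin C.n → ℕ} (hident : IsIdAssignment β C ident)
    {k : ℕ} (hk : ∀ v, C.x v = Nat.bits k) {X : Finset (Fin C.n)} {idx : Fin C.n → ℕ}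
    (hidx : ∀ v, idx v ≠ 0 ↔ v ∈ X) (hsurj : ∀ i < k, ∃ v, idx v = i + 1)
    (hX : ∀ S ⊆ X, ∃ (v : Fin C.n) (c : C.G.Walk v v), c.IsCycle ∧
      (∀ u ∈ S, u ∈ c.support) ∧ (∀ u ∈ X, u ∉ S → u ∉ c.support))
    (ℓ₂ : Fin C.n → List Bool) :
    ∃ ℓ₃, goodLabel c C ℓ₃ ∧ ∀ v,
      CycleDimCheck (nodeView C ident (threeLabels C (fun v => Nat.bits (idx v)) ℓ₂ ℓ₃) v)
        (nodeView C ident (threeLabels C (fun v => Nat.bits (idx v)) ℓ₂ ℓ₃) ''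
          C.G.neighborSet v) := by
  classical
  obtain ⟨r, p, hp, hpS, hpX⟩ := hX (X.filter fun v => decodeNat (ℓ₂ v) % 2 = 1)
    (Finset.filter_subset _ _)
  obtain ⟨M, q, hnum, hM, hsupp⟩ := CycleNumbering.of_isCycle hp
  have hgood : ∃ t, (∃ u, C.G.Adj t u ∧ decodeNat (ℓ₂ u) / 2 ≠ decodeNat (ℓ₂ t) / 2) ∨
      k ≤ decodeNat (ℓ₂ t) / 2 ∨ idx t = decodeNat (ℓ₂ t) / 2 + 1 := by
    by_contra! hno
    have hconst := C.conn.eq_of_forall_adj (f := fun v => decodeNat (ℓ₂ v) / 2)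
      fun u v huv => (hno u).1 v huv
    obtain ⟨v, hv⟩ := hsurj _ (hno r).2.1
    exact (hno v).2.2 (hv.trans (by rw [hconst r v]))
  obtain ⟨t, ht⟩ := hgood
  obtain ⟨d, hd, hdt⟩ := C.conn.exists_potential t
  obtain ⟨e, he, her⟩ := C.conn.exists_potential r
  rw [Fintype.card_fin] at hd he hM
  have hM2 := hnum.two_le
  have hn : 2 ≤ C.n := by omega
  let enc : Fin C.n → ℕ := fun v =>
    Nat.pair (d v) (Nat.pair (e v) (Nat.pair (ident r) (Nat.pair M (q v))))
  have hnβ : C.n ≤ C.n ^ β := Nat.le_self_pow (by omega) _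
  have hB : ∀ m ≤ C.n ^ β, m < 2 ^ (2 * β * Nat.log 2 C.n) := fun m hm =>
    hm.trans_lt (pow_lt_two_pow_log hn hβ)
  refine ⟨fun v => Nat.bits (enc v), fun v => length_bits_le ?_, fun v => ?_⟩
  · have h1 := hB (d v) (by have := hd v; omega)
    have h2 := hB (e v) (by have := he v; omega)
    have h3 := hB _ (hident.2 r).2
    have h4 := hB M (by omega)
    have h5 := hB (q v) (by have := hnum.le v; omega)
    generalize hL : 2 * β * Nat.log 2 C.n = L at h1 h2 h3 h4 h5
    have h45 := pair_lt_two_pow h4 h5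
    have h345 := pair_lt_two_pow (lt_two_pow_mono h3 (by omega)) h45
    have h2345 := pair_lt_two_pow (lt_two_pow_mono h2 (by omega)) h345
    have h12345 := pair_lt_two_pow (lt_two_pow_mono h1 (by omega)) h2345
    refine lt_two_pow_mono h12345 ?_
    calc 2 * (2 * (2 * (2 * L))) = 32 * β * Nat.log 2 C.n := by rw [← hL]; ring
      _ ≤ c * Nat.log 2 C.n := Nat.mul_le_mul_right _ hc
  · constructor <;> simp only [Set.forall_mem_image, Set.exists_mem_image, Set.image_nonempty,
      SimpleGraph.mem_neighborSet, NodeView.dim, NodeView.target, NodeView.index,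
      NodeView.targetPot, NodeView.cyclePot, NodeView.root, NodeView.last, NodeView.pos,
      NodeView.InTrace, nodeView, threeLabels_zero, threeLabels_one, threeLabels_two,
      decodeNat_bits, enc, Nat.unpair_pair, hk]
    case input => exact ⟨k, rfl⟩
    case nonempty =>
      have : Nontrivial (Fin C.n) := Fin.nontrivial_iff_two_le.2 hn
      exact C.conn.preconnected.exists_adj_of_nontrivial v
    case input_eq => exact fun _ _ => trivial
    case target =>
      rcases hdt v with rfl | hv
      · exact Or.inl ht
      · exact Or.inr hv
    case cycle =>
      rcases her v with rfl | hv
      · exact Or.inl ((hsupp v).1 p.start_mem_support)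
      · exact Or.inr hv
    case root_eq => exact fun _ _ => trivial
    case last_eq => exact fun _ _ => trivial
    case two_le => exact hM2
    case pos_le => exact hnum.le v
    case root => exact fun hv => by rw [hnum.root v hv]
    case close => exact hnum.close v
    case pred => exact hnum.pred v
    case succ =>
      exact fun hv w hw w' hw' hqw hqw' => by rw [hnum.succ v hv w w' hw hw' hqw hqw']
    case trace =>
      intro hv
      rw [← hsupp]
      have hvX := (hidx v).1 hv
      refine ⟨fun hmem => ?_, fun hodd => hpS v (Finset.mem_filter.2 ⟨hvX, hodd⟩)⟩
      by_contra hodd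
      exact hpX v hvX (fun hv' => hodd (Finset.mem_filter.1 hv').2) hmem

theorem exists_index {n : ℕ} (X : Finset (Fin n)) :
    ∃ idx : Fin n → ℕ, (∀ v, idx v ≠ 0 ↔ v ∈ X) ∧ (∀ v, idx v ≤ n) ∧
      ∀ i < X.card, ∃ v, idx v = i + 1 := by
  classical
  have hcard : X.card ≤ n := by simpa using X.card_le_univ
  refine ⟨fun v => if h : v ∈ X then X.equivFin ⟨v, h⟩ + 1 else 0, fun v => ?_, fun v => ?_,
    fun i hi => ⟨X.equivFin.symm ⟨i, hi⟩, ?_⟩⟩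
  · by_cases h : v ∈ X <;> simp [h]
  · by_cases h : v ∈ X
    · simp only [h, dif_pos]
      have := (X.equivFin ⟨v, h⟩).isLt
      omega
    · simp [h]
  · simp

/-- `VC-CYCLE-DIM ∈ Λ_3`. -/
theorem vcCycleDim_in_Lambda3 (α β : ℕ) (hα : 1 ≤ α) (hβ : 1 ≤ β) :
    LambdaC α β 3 VCCycleLang := by
  rw [LambdaC, if_pos (by norm_num)]
  refine ⟨oneRoundAlg CycleDimCheck, 32 * β + α + 1, fun C hC ident hident => ?_⟩
  simp only [altQ_three_iff, accepts_oneRoundAlg]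
  constructor
  · rintro ⟨k, hk, X, hkX, hX⟩
    obtain ⟨idx, hidx, hle, hsurj⟩ := exists_index X
    refine ⟨fun v => Nat.bits (idx v), fun v => ?_, fun ℓ₂ _ =>
      exists_check_of_shattered hβ (by omega) hident hk hidx
        (fun i hi => hsurj i (hi.trans_le hkX)) hX ℓ₂⟩
    obtain ⟨r, p, hp, -⟩ := hX ∅ (Finset.empty_subset _)
    have hn : 2 ≤ C.n := by
      have := hp.three_le_length
      have := hp.support_nodup.length_le_card
      simp only [List.length_tail, SimpleGraph.Walk.length_support, Fintype.card_fin] at this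
      omega
    have hlt : idx v < 2 ^ (2 * 1 * Nat.log 2 C.n) :=
      (hle v).trans_lt (by simpa using pow_lt_two_pow_log hn le_rfl)
    exact length_bits_le (lt_two_pow_mono hlt (Nat.mul_le_mul_right _ (by omega)))
  · rintro ⟨ℓ₁, -, h⟩
    refine mem_VCCycleLang_of_check (c := 32 * β + α + 1) (ℓ₁ := ℓ₁) hC (by omega) hident.1
      fun ℓ₂ hℓ₂ => ?_
    obtain ⟨ℓ₃, -, h₃⟩ := h ℓ₂ hℓ₂
    exact ⟨ℓ₃, h₃⟩
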